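/- arXiv:0911.2048 — 2 statements merged into one kernel-verified Lean document; each statement's English description precedes it below -/
import Mathlib

section
/- Let G be a finite group of order n. The following conditions are equivalent: (1) G is k-round for some integer k > n²; (2) G is k-round for every integer k ≥ 1 with gcd(k,n) = 1; (3) G is round; (4) G is nilpotent. -/
/-- A cycle of length `n = Nat.card G` over `G` is a function `ZMod n → G`.
It is `k`-round if for all integers `m₁, …, m_k`, the map
`i ↦ g (i+m₁) * g (i+m₂) * ⋯ * g (i+m_k)` is a bijection from `ZMod n` to `G`. -/
def IsRoundCycle (G : Type*) [Group G] (k : ℕ) (g : ZMod (Nat.card G) → G) : Prop :=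
  ∀ m : Fin k → ℤ,
    Function.Bijective fun i : ZMod (Nat.card G) =>
      (List.ofFn fun j : Fin k => g (i + (m j : ZMod (Nat.card G)))).prod

/-- `G` is `k`-round if it admits a `k`-round cycle. -/
def IsKRound (G : Type*) [Group G] (k : ℕ) : Prop :=
  ∃ g : ZMod (Nat.card G) → G, IsRoundCycle G k g

/-- A cycle is totally round if it is `k`-round for every `k ≥ 1` with `gcd(k, n) = 1`. -/
def IsTotallyRoundCycle (G : Type*) [Group G] (g : ZMod (Nat.card G) → G) : Prop :=
  ∀ k : ℕ, 1 ≤ k → Nat.gcd k (Nat.card G) = 1 → IsRoundCycle G k g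

/-- `G` is round if it admits a totally round cycle. -/
def IsRound (G : Type*) [Group G] : Prop :=
  ∃ g : ZMod (Nat.card G) → G, IsTotallyRoundCycle G g

open scoped Pointwise commutatorElement

/-- If `k` is at least the order of a finite group, then `T ^ k` is a coset of a subgroup `N`
normalised by the elements of `T`. -/
theorem exists_subgroup_of_card_le {Γ : Type*} [Group Γ] [Finite Γ] (T : Set Γ) {t : Γ}
    (ht : t ∈ T) {k : ℕ} (hk : Nat.card Γ ≤ k) :
    ∃ N : Subgroup Γ, (∀ x ∈ T, t⁻¹ * x ∈ N) ∧ (∀ x ∈ N, t⁻¹ * x * t ∈ N) ∧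
      (t ∈ N → 1 ∈ T ^ k) := by
  classical
  have : Fintype Γ := Fintype.ofFinite Γ
  have hpos : 0 < Nat.card Γ := Nat.card_pos
  have stab : ∀ i, Nat.card Γ ≤ i → ∀ j, t ^ j • T ^ i = T ^ (j + i) := by
    intro i hi j
    refine Set.eq_of_subset_of_ncard_le ?_ ?_ (Set.toFinite _)
    · rw [pow_add]
      rintro _ ⟨x, hx, rfl⟩
      exact Set.mul_mem_mul (Set.pow_mem_pow ht) hx
    · rw [Set.ncard_smul_set]
      have h : ∀ l, Nat.card Γ ≤ l → (T ^ l).ncard = (T ^ Fintype.card Γ).ncard := by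
        intro l hl
        have := Group.card_pow_eq_card_pow_card_univ T l (by rwa [← Nat.card_eq_fintype_card])
        simpa [← Nat.card_coe_set_eq, Nat.card_eq_fintype_card] using this
      rw [h _ hi, h _ (by omega)]
  obtain ⟨M, hMk, hM⟩ : ∃ M, k ≤ M ∧ t ^ M = 1 :=
    ⟨Nat.card Γ * k, Nat.le_mul_of_pos_left _ hpos, by rw [pow_mul, pow_card_eq_one', one_pow]⟩
  have hM0 : M = M - 1 + 1 := by omega
  have hmul : T ^ M * T ^ M = T ^ M := by
    rw [← pow_add, ← stab M (by omega) M, hM, one_smul]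
  refine ⟨subgroupOfIdempotent (T ^ M) ⟨t ^ M, Set.pow_mem_pow ht⟩ hmul, ?_, ?_, ?_⟩
  · intro x hx
    change t⁻¹ * x ∈ T ^ M
    have h1 : t⁻¹ = t ^ (M - 1) := by
      rw [inv_eq_iff_mul_eq_one, ← pow_succ', ← hM0, hM]
    rw [h1, hM0, pow_succ, Nat.add_sub_cancel]
    exact Set.mul_mem_mul (Set.pow_mem_pow ht) hx
  · intro x hx
    change x ∈ T ^ M at hx
    change t⁻¹ * x * t ∈ T ^ M
    have h1 : x * t ∈ t ^ 1 • T ^ M := by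
      rw [stab M (by omega) 1, add_comm, pow_succ]
      exact Set.mul_mem_mul hx ht
    rw [Set.mem_smul_set_iff_inv_smul_mem] at h1
    simpa [mul_assoc] using h1
  · intro h
    have h1 : t ^ (M - k) ∈ T ^ M := Subgroup.pow_mem _ h _
    rw [← Nat.sub_add_cancel hMk, ← stab k hk, Nat.sub_add_cancel hMk,
      Set.mem_smul_set_iff_inv_smul_mem] at h1
    simpa using h1

/-- Over a group with a `k`-round cycle, `k > n²`, each nontrivial element is central and nontrivial
in some quotient. -/
theorem exists_normal_of_isKRound {G : Type*} [Group G] [Finite G] {k : ℕ}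
    (hk : Nat.card G ^ 2 < k) (hG : IsKRound G k) (a : G) (ha : a ≠ 1) :
    ∃ B : Subgroup G, B.Normal ∧ a ∉ B ∧ ∀ x, ⁅a, x⁆ ∈ B := by
  obtain ⟨g, hg⟩ := hG
  have hpos : 0 < Nat.card G := Nat.card_pos
  have : NeZero (Nat.card G) := ⟨hpos.ne'⟩
  have ginj : Function.Injective g := by
    intro x y hxy
    apply (hg fun _ => 0).injective
    simp [hxy]
  have gbij : Function.Bijective g :=
    (Nat.bijective_iff_injective_and_card g).2 ⟨ginj, Nat.card_zmod _⟩
  obtain ⟨u, hu⟩ := gbij.surjective 1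
  obtain ⟨v, hv⟩ := gbij.surjective a
  let T : Set (G × G) := Set.range fun m => (g m, g (v - u + m))
  have ht : ((1 : G), a) ∈ T := ⟨u, by simp [hu, hv]⟩
  obtain ⟨N, hTN, hconj, hone⟩ := exists_subgroup_of_card_le T ht (k := k)
    (by rw [Nat.card_prod, ← pow_two]; exact hk.le)
  have hT : (1 : G × G) ∉ T ^ k := by
    intro h
    obtain ⟨f, hf⟩ := Set.mem_pow.1 h
    choose m hm using fun j => (f j).2
    choose m' hm' using fun j => ZMod.intCast_surjective (m j)
    have h1 : (List.ofFn fun j => g (0 + (m' j : ZMod (Nat.card G)))).prod = 1 := by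
      have := congrArg (MonoidHom.fst G G) hf
      rw [map_list_prod, List.map_ofFn] at this
      simpa [Function.comp_def, ← hm, hm'] using this
    have h2 : (List.ofFn fun j => g (v - u + (m' j : ZMod (Nat.card G)))).prod = 1 := by
      have := congrArg (MonoidHom.snd G G) hf
      rw [map_list_prod, List.map_ofFn] at this
      simpa [Function.comp_def, ← hm, hm'] using this
    have h3 := (hg m').injective (h1.trans h2.symm)
    apply ha
    rw [← hv, ← hu, sub_eq_zero.1 h3.symm]
  have hsurj : ∀ x, ∃ y, (y, x) ∈ N := by
    intro x
    obtain ⟨m, hm⟩ := gbij.surjective (a * x)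
    refine ⟨g (m - (v - u)), ?_⟩
    have := hTN (g (m - (v - u)), g m) ⟨m - (v - u), by simp⟩
    simpa [hm] using this
  have hB : ∀ x, a⁻¹ * x * a * x⁻¹ ∈ N.comap (MonoidHom.inr G G) := by
    intro x
    obtain ⟨y, hy⟩ := hsurj x
    have := N.mul_mem (hconj _ hy) (N.inv_mem hy)
    simpa using this
  have hnormal : (N.comap (MonoidHom.inr G G)).Normal := by
    refine ⟨fun b hb x => ?_⟩
    obtain ⟨y, hy⟩ := hsurj x
    have := N.mul_mem (N.mul_mem hy hb) (N.inv_mem hy)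
    simpa using this
  refine ⟨_, hnormal, fun h => hT (hone h), fun x => ?_⟩
  simpa [commutatorElement_def, mul_assoc] using
    hnormal.conj_mem _ (Subgroup.inv_mem _ (hB x)) a

/-- If each nontrivial element is central and nontrivial in some quotient of the finite group `G`,
then no nontrivial normal subgroup `K` satisfies `⁅K, ⊤⁆ = K`. -/
theorem eq_bot_of_commutator_top_eq {G : Type*} [Group G] [Finite G]
    (h : ∀ a : G, a ≠ 1 → ∃ B : Subgroup G, B.Normal ∧ a ∉ B ∧ ∀ x, ⁅a, x⁆ ∈ B)
    {K : Subgroup G} (hK : K.Normal) (hKG : ⁅K, (⊤ : Subgroup G)⁆ = K) : K = ⊥ := by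
  by_contra hne
  obtain ⟨L, ⟨hL, hLK⟩, hLmax⟩ := Set.Finite.exists_maximal
    (Set.toFinite {L : Subgroup G | L.Normal ∧ L < K}) ⟨⊥, inferInstance, bot_lt_iff_ne_bot.2 hne⟩
  obtain ⟨M, ⟨hM, hMK, hML⟩, hMmin⟩ := Set.Finite.exists_minimal
    (Set.toFinite {M : Subgroup G | M.Normal ∧ M ≤ K ∧ ¬ M ≤ L}) ⟨K, hK, le_rfl, hLK.not_ge⟩
  obtain ⟨a, haM, haL⟩ := SetLike.not_le_iff_exists.1 hML
  obtain ⟨B, hB, haB, hcomm⟩ := h a (fun h => haL (h ▸ L.one_mem))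
  have hMB : M ⊓ B ≤ L := by
    by_contra hc
    exact haB ((hMmin ⟨inferInstance, inf_le_left.trans hMK, hc⟩ inf_le_left haM).2)
  have hclo : Subgroup.normalClosure {a} = M := by
    have hle : Subgroup.normalClosure {a} ≤ M := Subgroup.normalClosure_le_normal (by simpa)
    exact hle.antisymm (hMmin ⟨inferInstance, hle.trans hMK,
      fun hc => haL (hc (Subgroup.subset_normalClosure rfl))⟩ hle)
  have hMcomm : ⁅M, (⊤ : Subgroup G)⁆ ≤ B := by
    rw [← QuotientGroup.ker_mk' B, ← Subgroup.map_eq_bot_iff, Subgroup.map_commutator,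
      Subgroup.map_top_of_surjective _ (QuotientGroup.mk'_surjective B),
      Subgroup.commutator_eq_bot_iff_le_centralizer, Subgroup.map_le_iff_le_comap, ← hclo]
    have : (Subgroup.comap (QuotientGroup.mk' B)
        (Subgroup.centralizer ((⊤ : Subgroup (G ⧸ B)) : Set (G ⧸ B)))).Normal := by
      rw [Subgroup.coe_top, Subgroup.centralizer_univ]
      infer_instance
    apply Subgroup.normalClosure_le_normal
    simp only [Set.singleton_subset_iff, SetLike.mem_coe, Subgroup.mem_comap,
      Subgroup.mem_centralizer_iff]
    intro y _
    obtain ⟨x, rfl⟩ := QuotientGroup.mk'_surjective B y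
    symm
    rw [← commutatorElement_eq_one_iff_mul_comm, ← map_commutatorElement]
    exact (QuotientGroup.eq_one_iff _).2 (hcomm x)
  have hsup : M ⊔ L = K := by
    by_contra hc
    exact hML (le_sup_left.trans (hLmax ⟨inferInstance, lt_of_le_of_ne (sup_le hMK hLK.le) hc⟩
      le_sup_right))
  apply hLK.not_ge
  have hML' : ⁅M, (⊤ : Subgroup G)⁆ ≤ (QuotientGroup.mk' L).ker := by
    rw [QuotientGroup.ker_mk']
    exact (le_inf (Subgroup.commutator_le_left _ _) hMcomm).trans hMB
  rw [← hKG, ← hsup, ← QuotientGroup.ker_mk' L, ← Subgroup.map_eq_bot_iff, Subgroup.map_commutator,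
    Subgroup.map_sup, QuotientGroup.ker_mk', QuotientGroup.map_mk'_self, sup_bot_eq,
    ← Subgroup.map_commutator, Subgroup.map_eq_bot_iff]
  exact hML'

theorem isNilpotent_of_isKRound {G : Type*} [Group G] [Finite G] {k : ℕ}
    (hk : Nat.card G ^ 2 < k) (hG : IsKRound G k) : Group.IsNilpotent G := by
  obtain ⟨n, hn⟩ := WellFoundedLT.antitone_chain_condition
    (Subgroup.lowerCentralSeries_antitone (⊤ : Subgroup G))
  rw [Subgroup.nilpotent_iff_lowerCentralSeries]
  exact ⟨n, eq_bot_of_commutator_top_eq (exists_normal_of_isKRound hk hG)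
    inferInstance (hn (n + 1) n.le_succ).symm⟩

theorem List.prod_map_mul_zpow_of_commute {G ι : Type*} [Group G] {z : G}
    (hz : ∀ x, Commute z x) (a : ι → G) (e : ι → ℤ) (l : List ι) :
    (l.map fun j => a j * z ^ e j).prod = (l.map a).prod * z ^ (l.map e).sum := by
  induction l with
  | nil => simp
  | cons j l ih =>
    simp only [List.map_cons, List.prod_cons, List.sum_cons, ih, zpow_add]
    rw [mul_assoc, mul_assoc, ← mul_assoc (z ^ e j), ((hz _).zpow_left (e j)).eq, mul_assoc]

/-- A nilpotent group has a totally round cycle, written as a periodic function on `ℤ`. -/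
theorem exists_periodic_round (n : ℕ) : ∀ (G : Type*) [Group G] [Finite G] [Group.IsNilpotent G],
    Nat.card G = n → ∃ f : ℤ → G, (∀ i j, i ≡ j [ZMOD n] → f i = f j) ∧
      ∀ l : List ℤ, Nat.Coprime l.length n → ∀ i j : ℤ,
        (l.map fun m => f (i + m)).prod = (l.map fun m => f (j + m)).prod → i ≡ j [ZMOD n] := by
  induction n using Nat.strong_induction_on with
  | _ n ih =>
  intro G _ _ _ hn
  rcases subsingleton_or_nontrivial G with hG | hG
  · have : n = 1 := by rw [← hn, Nat.card_unique]
    subst this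
    exact ⟨1, fun _ _ _ => rfl, fun _ _ i j _ => by simpa using Int.modEq_one⟩
  obtain ⟨z, hz, hz1⟩ := (Subgroup.bot_or_exists_ne_one (Subgroup.center G)).resolve_left
    (Group.IsNilpotent.center_ne_bot G)
  have hzc : ∀ x, Commute z x := fun x => (Subgroup.mem_center_iff.1 hz x).symm
  have hnorm : (Subgroup.zpowers z).Normal := by
    refine ⟨fun b hb x => ?_⟩
    obtain ⟨e, rfl⟩ := hb
    rw [← ((hzc x).zpow_left e).eq]
    simp
  have hcard := Subgroup.card_eq_card_quotient_mul_card_subgroup (Subgroup.zpowers z)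
  rw [Nat.card_zpowers, hn] at hcard
  set q := Nat.card (G ⧸ Subgroup.zpowers z) with hq
  have hqpos : 0 < q := Nat.card_pos
  have hd : 1 < orderOf z := by
    have := orderOf_pos z
    have := mt orderOf_eq_one_iff.1 hz1
    omega
  have hlt : q < n := by
    rw [hcard]
    exact lt_mul_of_one_lt_right hqpos hd
  obtain ⟨h, hper, hround⟩ := ih q hlt (G ⧸ Subgroup.zpowers z) rfl
  have hshift : ∀ i t : ℤ, (h (i + q * t)).out * z ^ ((i + q * t) / q) =
      (h i).out * z ^ (i / q + t) := by
    intro i t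
    rw [hper (i + q * t) i (by simp [Int.ModEq]), Int.add_mul_ediv_left _ _ (by omega)]
  refine ⟨fun i => (h i).out * z ^ (i / q), ?_, ?_⟩
  · intro i j hij
    obtain ⟨c, hc⟩ := hij.dvd
    obtain rfl : j = i + q * (orderOf z * c) := by
      rw [hcard] at hc
      push_cast at hc
      linear_combination hc
    simp only [hshift]
    rw [zpow_add, zpow_mul, zpow_natCast, pow_orderOf_eq_one, one_zpow, mul_one]
  · intro l hl i j hij
    have hcop : Nat.Coprime l.length q ∧ Nat.Coprime l.length (orderOf z) := by
      rw [hcard] at hl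
      exact Nat.coprime_mul_iff_right.1 hl
    have hmod : i ≡ j [ZMOD q] := by
      apply hround l hcop.1
      have := congrArg (QuotientGroup.mk' (Subgroup.zpowers z)) hij
      have hmk : ∀ m, QuotientGroup.mk' (Subgroup.zpowers z) ((h m).out * z ^ (m / q)) = h m := by
        intro m
        rw [map_mul, QuotientGroup.mk'_apply, QuotientGroup.mk'_apply,
          (QuotientGroup.eq_one_iff (z ^ (m / (q : ℤ)))).2
            (Subgroup.zpow_mem_zpowers z _), mul_one]
        exact Quotient.out_eq' (h m)
      simpa only [map_list_prod, List.map_map, Function.comp_def, hmk] using this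
    obtain ⟨t, ht⟩ := hmod.dvd
    obtain rfl : j = i + q * t := by linear_combination ht
    simp only [add_right_comm i, hshift, List.prod_map_mul_zpow_of_commute hzc] at hij
    have hsum : (l.map fun m => (i + m) / (q : ℤ) + t).sum =
        (l.map fun m => (i + m) / (q : ℤ)).sum + l.length * t := by
      rw [List.sum_map_add]
      simp
    rw [hsum, zpow_add, mul_right_inj, left_eq_mul, ← orderOf_dvd_iff_zpow_eq_one] at hij
    have hdt : (orderOf z : ℤ) ∣ t :=
      (Nat.isCoprime_iff_coprime.2 hcop.2.symm).dvd_of_dvd_mul_left hij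
    rw [Int.modEq_iff_dvd, hcard]
    push_cast
    simpa using mul_dvd_mul_left (q : ℤ) hdt

theorem isRound_of_isNilpotent (G : Type*) [Group G] [Finite G] [Group.IsNilpotent G] :
    IsRound G := by
  obtain ⟨f, hper, hround⟩ := exists_periodic_round (Nat.card G) G rfl
  have hpos : 0 < Nat.card G := Nat.card_pos
  have : NeZero (Nat.card G) := ⟨hpos.ne'⟩
  refine ⟨fun i => f i.cast, fun k _ hk m => ?_⟩
  refine (Nat.bijective_iff_injective_and_card _).2 ⟨fun i j hij => ?_, Nat.card_zmod _⟩
  have key : ∀ (x : ZMod (Nat.card G)) (y : ℤ), f (x + y : ZMod (Nat.card G)).cast =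
      f (x.cast + y) := by
    intro x y
    apply hper
    rw [← ZMod.intCast_eq_intCast_iff]
    simp
  simp only [key] at hij
  have := hround (List.ofFn m) (by simpa [Nat.Coprime] using hk) i.cast j.cast
    (by simpa [List.map_ofFn, Function.comp_def] using hij)
  rw [← ZMod.intCast_eq_intCast_iff] at this
  simpa using this

/-- Let `G` be a finite group of order `n`. The following are equivalent:
(1) `G` is `k`-round for some `k > n²`;
(2) `G` is `k`-round for every `k ≥ 1` with `gcd(k, n) = 1`;
(3) `G` is round;
(4) `G` is nilpotent. -/
theorem statement0 (G : Type*) [Group G] [Finite G] :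
    List.TFAE
      [∃ k : ℕ, Nat.card G ^ 2 < k ∧ IsKRound G k,
       ∀ k : ℕ, 1 ≤ k → Nat.gcd k (Nat.card G) = 1 → IsKRound G k,
       IsRound G,
       Group.IsNilpotent G] := by
  tfae_have 3 → 2 := fun ⟨g, hg⟩ k hk hkn => ⟨g, hg k hk hkn⟩
  tfae_have 2 → 1 := by
    intro h
    have hpos : 0 < Nat.card G := Nat.card_pos
    refine ⟨Nat.card G * Nat.card G ^ 2 + 1, ?_, h _ (by omega) (by simp)⟩
    exact Nat.lt_succ_of_le (Nat.le_mul_of_pos_left _ hpos)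
  tfae_have 1 → 4 := fun ⟨_, hk, hG⟩ => isNilpotent_of_isKRound hk hG
  tfae_have 4 → 3 := fun _ => isRound_of_isNilpotent G
  tfae_finish
end

section
/- Let G be a finite group of order n. The following four conditions are equivalent: (1) G admits a strongly 1-round cycle; (2) G admits a strongly k-round cycle for some integer k; (3) G admits a strongly k-round cycle for every integer k ≥ 1 with gcd(k,n) = 1; (4) G is round. -/
/-- A cycle `g` of length `n = Nat.card G` over `G` is strongly `k`-round if for every
`l ≥ 1`, all integers `m₁, …, m_l`, and all signs `ε₁, …, ε_l ∈ {−1, 1}` with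
`ε₁ + ⋯ + ε_l = k`, the map `i ↦ g(i+m₁)^{ε₁} ⋯ g(i+m_l)^{ε_l}` is a bijection. -/
def IsStronglyRoundCycle (G : Type*) [Group G] (k : ℤ) (g : ZMod (Nat.card G) → G) :
    Prop :=
  ∀ l : ℕ, 1 ≤ l → ∀ m : Fin l → ℤ, ∀ ε : Fin l → ℤ,
    (∀ j, ε j = 1 ∨ ε j = -1) → (∑ j : Fin l, ε j) = k →
    Function.Bijective fun i : ZMod (Nat.card G) =>
      (List.ofFn fun j : Fin l => (g (i + (m j : ZMod (Nat.card G)))) ^ (ε j)).prod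

/-- The subgroup of pairs `(k, f)` such that `f` is the map `i ↦ ∏ g (i + mⱼ) ^ εⱼ` given by some
word in translates of `g`, and `k` is the exponent sum of that word modulo `n`. -/
noncomputable def cycleWords {G : Type*} [Group G] (g : ZMod (Nat.card G) → G) :
    Subgroup (Multiplicative (ZMod (Nat.card G)) × (ZMod (Nat.card G) → G)) :=
  Subgroup.closure (Set.range fun m : ℤ => (Multiplicative.ofAdd 1, fun i => g (i + m)))

section

variable {G : Type*} [Group G] {g : ZMod (Nat.card G) → G}

theorem ofAdd_one_translate_mem_cycleWords (m : ℤ) :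
    (Multiplicative.ofAdd 1, fun i => g (i + m)) ∈ cycleWords g :=
  Subgroup.subset_closure ⟨m, rfl⟩

theorem IsStronglyRoundCycle.of_cycleWords {k : ℤ}
    (h : ∀ f, (Multiplicative.ofAdd (k : ZMod (Nat.card G)), f) ∈ cycleWords g →
      Function.Bijective f) :
    IsStronglyRoundCycle G k g := by
  intro l _ m ε _ hk
  apply h
  have hmem : (List.ofFn fun j : Fin l =>
      ((Multiplicative.ofAdd 1, fun i => g (i + m j)) :
        Multiplicative (ZMod (Nat.card G)) × (ZMod (Nat.card G) → G)) ^ ε j).prod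
        ∈ cycleWords g := by
    refine Subgroup.list_prod_mem _ fun x hx => ?_
    obtain ⟨j, rfl⟩ := (List.mem_ofFn' _ _).1 hx
    exact Subgroup.zpow_mem _ (ofAdd_one_translate_mem_cycleWords _) _
  convert hmem using 1
  refine Prod.ext ?_ ?_
  · rw [← MonoidHom.coe_fst, map_list_prod, List.map_ofFn, List.prod_ofFn, ← hk]
    simp [← ofAdd_zsmul, ← ofAdd_sum]
  · funext i
    change _ = (Pi.evalMonoidHom (fun _ => G) i).comp (MonoidHom.snd _ _) (List.prod _)
    rw [map_list_prod, List.map_ofFn]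
    rfl

theorem IsStronglyRoundCycle.bijective_list_prod {k : ℤ} (h : IsStronglyRoundCycle G k g)
    (L : List (ℤ × ℤ)) (hL : L ≠ []) (hε : ∀ p ∈ L, p.2 = 1 ∨ p.2 = -1)
    (hk : (L.map Prod.snd).sum = k) :
    Function.Bijective fun i => (L.map fun p => g (i + (p.1 : ℤ)) ^ p.2).prod := by
  have := h L.length (List.length_pos_iff.2 hL) (fun j => (L.get j).1) (fun j => (L.get j).2)
    (fun j => hε _ (L.get_mem j)) (by
      rw [← hk, ← List.sum_ofFn]
      congr 1
      exact List.map_ofFn.symm.trans (by rw [List.ofFn_get]))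
  convert this using 3 with i
  conv_lhs => rw [← List.ofFn_get L, List.map_ofFn]
  rfl

theorem IsRoundCycle.bijective_list_prod {L : List ℤ} (h : IsRoundCycle G L.length g) :
    Function.Bijective fun i => (L.map fun m => g (i + (m : ℤ))).prod := by
  convert h L.get using 3 with i
  conv_lhs => rw [← List.ofFn_get L, List.map_ofFn]
  rfl

theorem IsStronglyRoundCycle.isRoundCycle {k : ℕ} (hk : 1 ≤ k)
    (h : IsStronglyRoundCycle G k g) : IsRoundCycle G k g := by
  intro m
  simpa using h k hk m (fun _ => 1) (fun _ => Or.inl rfl) (by simp)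

variable [Finite G]

theorem exists_list_of_mem_cycleWords
    {x : Multiplicative (ZMod (Nat.card G)) × (ZMod (Nat.card G) → G)} (hx : x ∈ cycleWords g) :
    ∃ L : List ℤ, L ≠ [] ∧ x.1 = Multiplicative.ofAdd (L.length : ZMod (Nat.card G)) ∧
      x.2 = fun i => (L.map fun m => g (i + (m : ℤ))).prod := by
  have : NeZero (Nat.card G) := ⟨Nat.card_pos.ne'⟩
  rw [cycleWords, ← Subgroup.mem_toSubmonoid, Subgroup.closure_toSubmonoid_of_finite] at hx
  induction hx using Submonoid.closure_induction with
  | mem x hx =>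
    obtain ⟨m, rfl⟩ := hx
    exact ⟨[m], by simp⟩
  | one =>
    refine ⟨List.replicate (Nat.card G) 0, by simp [NeZero.ne], by simp, ?_⟩
    funext i
    simp
  | mul x y _ _ hx hy =>
    obtain ⟨L, hL, hx₁, hx₂⟩ := hx
    obtain ⟨M, -, hy₁, hy₂⟩ := hy
    refine ⟨L ++ M, by simp [hL], by simp [hx₁, hy₁], ?_⟩
    funext i
    simp [hx₂, hy₂]

theorem IsStronglyRoundCycle.bijective_of_mem_cycleWords {k : ℤ}
    (h : IsStronglyRoundCycle G k g) {f : ZMod (Nat.card G) → G}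
    (hf : (Multiplicative.ofAdd (k : ZMod (Nat.card G)), f) ∈ cycleWords g) :
    Function.Bijective f := by
  obtain ⟨L, hL, hk, rfl⟩ := exists_list_of_mem_cycleWords hf
  replace hk : ((L.length : ℤ) : ZMod (Nat.card G)) = (k : ZMod (Nat.card G)) := by
    simpa using (Multiplicative.ofAdd.injective hk).symm
  obtain ⟨t, ht⟩ := (ZMod.intCast_eq_intCast_iff_dvd_sub _ _ _).1 hk
  have := h.bijective_list_prod
    (L.map (fun m => (m, (1 : ℤ))) ++
      List.replicate (Nat.card G * t.natAbs) ((0 : ℤ), if 0 ≤ t then (1 : ℤ) else -1))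
    (by simp [hL])
    (by
      intro p hp
      rw [List.mem_append, List.mem_map] at hp
      rcases hp with ⟨m, -, rfl⟩ | hp
      · simp
      · rw [List.eq_of_mem_replicate hp]
        split_ifs <;> simp)
    (by
      have ht' : (t.natAbs : ℤ) * (if 0 ≤ t then (1 : ℤ) else -1) = t := by
        split_ifs <;> omega
      simp only [List.map_append, List.map_map, List.sum_append, List.map_replicate,
        List.sum_replicate, nsmul_eq_mul, Nat.cast_mul, mul_assoc, ht', ← ht]
      simp [Function.comp_def])
  simpa [Function.comp_def, pow_mul] using this

theorem IsTotallyRoundCycle.isStronglyRoundCycle_one (h : IsTotallyRoundCycle G g) :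
    IsStronglyRoundCycle G 1 g := by
  refine .of_cycleWords fun f hf => ?_
  obtain ⟨L, hL, hk, rfl⟩ := exists_list_of_mem_cycleWords hf
  refine (h L.length (List.length_pos_iff.2 hL) ?_).bijective_list_prod
  rw [← Nat.coprime_iff_gcd_eq_one, ← ZMod.isUnit_iff_coprime,
    ← Multiplicative.ofAdd.injective hk]
  simp

theorem IsStronglyRoundCycle.of_coprime (h : IsStronglyRoundCycle G 1 g) {k : ℕ}
    (hk : Nat.gcd k (Nat.card G) = 1) : IsStronglyRoundCycle G k g := by
  have : NeZero (Nat.card G) := ⟨Nat.card_pos.ne'⟩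
  refine .of_cycleWords fun f hf => ?_
  obtain ⟨a, ha⟩ := ((ZMod.isUnit_iff_coprime k (Nat.card G)).2 hk).exists_right_inv
  have hfa : Function.Bijective (f ^ a.val) := by
    apply h.bijective_of_mem_cycleWords
    convert Subgroup.pow_mem _ hf a.val using 1
    rw [Prod.pow_mk, ← ofAdd_nsmul]
    simp [mul_comm a, ha]
  refine Function.Injective.bijective_of_nat_card_le (fun i j hij => hfa.injective ?_) (by simp)
  simp [hij]

theorem IsStronglyRoundCycle.zpow {k : ℤ} (h : IsStronglyRoundCycle G k g) :
    IsStronglyRoundCycle G 1 (g ^ k) := by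
  refine .of_cycleWords fun f hf => h.bijective_of_mem_cycleWords ?_
  have key : cycleWords (g ^ k) ≤ (cycleWords g).comap
      ((zpowGroupHom k : Multiplicative (ZMod (Nat.card G)) →* _).prodMap (MonoidHom.id _)) := by
    rw [cycleWords, Subgroup.closure_le]
    rintro _ ⟨m, rfl⟩
    exact Subgroup.zpow_mem _ (ofAdd_one_translate_mem_cycleWords m) k
  simpa [Subgroup.mem_comap, ← ofAdd_zsmul] using key hf

end

/-- Let `G` be a finite group of order `n`. The following are equivalent:
(1) `G` admits a strongly `1`-round cycle;
(2) `G` admits a strongly `k`-round cycle for some integer `k`;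
(3) `G` admits a strongly `k`-round cycle for every integer `k ≥ 1` with `gcd(k,n) = 1`;
(4) `G` is round. -/
theorem statement19 (G : Type*) [Group G] [Finite G] :
    List.TFAE
      [∃ g : ZMod (Nat.card G) → G, IsStronglyRoundCycle G 1 g,
       ∃ k : ℤ, ∃ g : ZMod (Nat.card G) → G, IsStronglyRoundCycle G k g,
       ∀ k : ℕ, 1 ≤ k → Nat.gcd k (Nat.card G) = 1 →
         ∃ g : ZMod (Nat.card G) → G, IsStronglyRoundCycle G (k : ℤ) g,
       IsRound G] := by
  tfae_have 1 → 2 := fun h => ⟨1, h⟩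
  tfae_have 2 → 1 := fun ⟨k, g, hg⟩ => ⟨g ^ k, hg.zpow⟩
  tfae_have 1 → 3 := fun ⟨g, hg⟩ k _ hk => ⟨g, hg.of_coprime hk⟩
  tfae_have 3 → 1 := fun h => by simpa using h 1 le_rfl (Nat.gcd_one_left _)
  tfae_have 1 → 4 := fun ⟨g, hg⟩ => ⟨g, fun k hk hkn => (hg.of_coprime hkn).isRoundCycle hk⟩
  tfae_have 4 → 1 := fun ⟨g, hg⟩ => ⟨g, hg.isStronglyRoundCycle_one⟩
  tfae_finish
end
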